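/- arXiv:math/0212039 — 3 statements merged into one kernel-verified Lean document; each statement's English description precedes it below -/
import Mathlib

section
/- Let p be an odd prime and U a finite-dimensional F_p-vector space. The kernel of the multiplication map S²(Λ²U^∨) → Λ⁴U^∨ is equal to the image in (U^∨)^{⊗4} (under symmetrization) of the composite U^∨ ⊗ S²U^∨ ⊗ U^∨ → Λ²U^∨ ⊗ Λ²U^∨ → S²(Λ²U^∨); explicitly, it is generated by the elements (1/2)(u∧v · w∧x + u∧w · v∧x) for u,v,w,x ∈ U^∨. -/
open ExteriorAlgebra
open scoped TensorProduct

set_option maxHeartbeats 1000000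
set_option synthInstance.maxHeartbeats 400000

/-- The bivector `u ∧ v`, as an element of the second exterior power `⋀²D`. -/
noncomputable def wedge2 {R : Type*} [CommRing R] {D : Type*} [AddCommGroup D] [Module R D]
    (u v : D) : (⋀[R]^2 D : Submodule R (ExteriorAlgebra R D)) :=
  ⟨ιMulti R 2 ![u, v], ιMulti_range R 2 (Set.mem_range_self _)⟩

/-- The multiplication map `Λ²D ⊗ Λ²D → Λ⁴D ⊆ ExteriorAlgebra D` induced by the wedge
product. -/
noncomputable def wedgeMul (R : Type*) [CommRing R] (D : Type*) [AddCommGroup D]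
    [Module R D] :
    ((⋀[R]^2 D : Submodule R (ExteriorAlgebra R D)) ⊗[R]
      (⋀[R]^2 D : Submodule R (ExteriorAlgebra R D))) →ₗ[R] ExteriorAlgebra R D :=
  TensorProduct.lift ((LinearMap.mul R (ExteriorAlgebra R D)).compl₁₂
    (⋀[R]^2 D).subtype (⋀[R]^2 D).subtype)

section wedge2

variable {R : Type*} [CommRing R] {D : Type*} [AddCommGroup D] [Module R D]

theorem coe_wedge2 (u v : D) : ((wedge2 u v : ⋀[R]^2 D) : ExteriorAlgebra R D) = ι R u * ι R v := by
  simp [wedge2, ιMulti_apply]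

theorem wedge2_self (u : D) : (wedge2 u u : ⋀[R]^2 D) = 0 :=
  Subtype.ext (by simp [coe_wedge2])

theorem wedge2_swap (u v : D) : (wedge2 u v : ⋀[R]^2 D) = -wedge2 v u :=
  Subtype.ext (by
    simpa [coe_wedge2] using eq_neg_of_add_eq_zero_left (ι_add_mul_swap u v))

theorem ιMulti_eq_wedge2 (v : Fin 2 → D) : exteriorPower.ιMulti R 2 v = wedge2 (v 0) (v 1) :=
  Subtype.ext (by simp [coe_wedge2, ιMulti_apply, Matrix.vecTail])

theorem span_wedge2 :
    Submodule.span R {a : ⋀[R]^2 D | ∃ u v : D, wedge2 u v = a} = ⊤ := by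
  rw [← exteriorPower.ιMulti_span R 2 D]
  congr 1
  ext a
  constructor
  · rintro ⟨u, v, rfl⟩
    exact ⟨![u, v], by simp [ιMulti_eq_wedge2]⟩
  · rintro ⟨v, rfl⟩
    exact ⟨v 0, v 1, (ιMulti_eq_wedge2 v).symm⟩

/-- Bilinear maps on `⋀²D` are determined by their values on decomposable bivectors. -/
theorem bilin_ext_wedge2 {W : Type*} [AddCommGroup W] [Module R W]
    {f g : ⋀[R]^2 D →ₗ[R] ⋀[R]^2 D →ₗ[R] W}
    (h : ∀ u v w x : D, f (wedge2 u v) (wedge2 w x) = g (wedge2 u v) (wedge2 w x)) : f = g := by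
  refine LinearMap.ext_on span_wedge2 ?_
  rintro _ ⟨u, v, rfl⟩
  refine LinearMap.ext_on span_wedge2 ?_
  rintro _ ⟨w, x, rfl⟩
  exact h u v w x

@[simp]
theorem wedgeMul_tmul (a b : ⋀[R]^2 D) :
    wedgeMul R D (a ⊗ₜ[R] b) = (a : ExteriorAlgebra R D) * b := rfl

theorem wedge2_mul_add_swap (u v w x : D) :
    ((wedge2 u v : ⋀[R]^2 D) : ExteriorAlgebra R D) * (wedge2 w x : ⋀[R]^2 D) +
      ((wedge2 u w : ⋀[R]^2 D) : ExteriorAlgebra R D) * (wedge2 v x : ⋀[R]^2 D) = 0 := by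
  have h := ι_add_mul_swap (R := R) v w
  simp only [coe_wedge2]
  calc _ = ι R u * (ι R v * ι R w + ι R w * ι R v) * ι R x := by noncomm_ring
    _ = 0 := by rw [h]; simp

/-- Elements of `⋀²D` commute in the exterior algebra. -/
theorem mul_comm_of_exteriorPower_two (a b : ⋀[R]^2 D) :
    (a : ExteriorAlgebra R D) * b = b * a := by
  let f : ⋀[R]^2 D →ₗ[R] ⋀[R]^2 D →ₗ[R] ExteriorAlgebra R D :=
    (LinearMap.mul R (ExteriorAlgebra R D)).compl₁₂ (⋀[R]^2 D).subtype (⋀[R]^2 D).subtype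
  have h : f = f.flip := by
    refine bilin_ext_wedge2 fun u v w x => ?_
    change ((wedge2 u v : ⋀[R]^2 D) : ExteriorAlgebra R D) * (wedge2 w x : ⋀[R]^2 D) =
      ((wedge2 w x : ⋀[R]^2 D) : ExteriorAlgebra R D) * (wedge2 u v : ⋀[R]^2 D)
    have s (y z : D) : ι R y * ι R z = -(ι R z * ι R y) :=
      eq_neg_of_add_eq_zero_left (ι_add_mul_swap y z)
    simp only [coe_wedge2]
    calc ι R u * ι R v * (ι R w * ι R x) = ι R u * (ι R v * ι R w) * ι R x := by noncomm_ring
      _ = -((ι R u * ι R w) * (ι R v * ι R x)) := by rw [s v w]; noncomm_ring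
      _ = -(ι R w * (ι R u * ι R x) * ι R v) := by rw [s u w, s v x]; noncomm_ring
      _ = ι R w * ι R x * (ι R u * ι R v) := by rw [s u x]; noncomm_ring
  exact LinearMap.congr_fun₂ h a b

/-- The multilinear map `(u, v, w, x) ↦ q (u∧v ⊗ w∧x)`. -/
noncomputable def mapWedge2Tmul {W : Type*} [AddCommGroup W] [Module R W]
    (q : (⋀[R]^2 D) ⊗[R] (⋀[R]^2 D) →ₗ[R] W) : MultilinearMap R (fun _ : Fin 4 => D) W :=
  q.compMultilinearMap
    (((exteriorPower.ιMulti R 2 (M := D)).toMultilinearMap.domCoprod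
      (exteriorPower.ιMulti R 2 (M := D)).toMultilinearMap).domDomCongr
        (finSumFinEquiv (m := 2) (n := 2)))

theorem mapWedge2Tmul_apply {W : Type*} [AddCommGroup W] [Module R W]
    (q : (⋀[R]^2 D) ⊗[R] (⋀[R]^2 D) →ₗ[R] W) (v : Fin 4 → D) :
    mapWedge2Tmul q v = q (wedge2 (v 0) (v 1) ⊗ₜ wedge2 (v 2) (v 3)) := by
  refine congrArg q (congrArg₂ (· ⊗ₜ[R] ·) (ιMulti_eq_wedge2 _) (ιMulti_eq_wedge2 _))

/-- A linear map on `⋀²D ⊗ ⋀²D` that kills all `u∧v ⊗ v∧x` gives an alternating map of four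
variables. -/
noncomputable def alternatingOfSelf {W : Type*} [AddCommGroup W] [Module R W]
    (q : (⋀[R]^2 D) ⊗[R] (⋀[R]^2 D) →ₗ[R] W)
    (hself : ∀ u v x : D, q (wedge2 u v ⊗ₜ wedge2 v x) = 0) :
    D [⋀^Fin 4]→ₗ[R] W where
  __ := mapWedge2Tmul q
  map_eq_zero_of_eq' v i j h hij := by
    have left (a b c : D) : q (wedge2 a b ⊗ₜ wedge2 a c) = 0 := by
      rw [wedge2_swap a b, ← neg_one_smul R, ← TensorProduct.smul_tmul', map_smul, hself, smul_zero]
    have right (a b c : D) : q (wedge2 a b ⊗ₜ wedge2 c b) = 0 := by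
      rw [wedge2_swap c b, ← neg_one_smul R, TensorProduct.tmul_smul, map_smul, hself, smul_zero]
    have outer (a b c : D) : q (wedge2 a b ⊗ₜ wedge2 c a) = 0 := by
      rw [wedge2_swap c a, ← neg_one_smul R, TensorProduct.tmul_smul, map_smul, left, smul_zero]
    refine (mapWedge2Tmul_apply q v).trans ?_
    fin_cases i <;> fin_cases j <;>
      simp only [Fin.zero_eta, Fin.mk_one, Fin.reduceFinMk, ne_eq, not_true_eq_false] at h hij <;>
      simp [h, hself, left, right, outer, wedge2_self]

end wedge2

/-- The antisymmetric tensors in `⋀²D ⊗ ⋀²D` together with the elements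
`½(u∧v ⊗ w∧x + u∧w ⊗ v∧x)`. -/
def wedgeRelations (K : Type*) [Field K] (D : Type*) [AddCommGroup D] [Module K D] :
    Set ((⋀[K]^2 D : Submodule K (ExteriorAlgebra K D)) ⊗[K]
      (⋀[K]^2 D : Submodule K (ExteriorAlgebra K D))) :=
  {t | ∃ a b : (⋀[K]^2 D : Submodule K (ExteriorAlgebra K D)),
      t = a ⊗ₜ[K] b - b ⊗ₜ[K] a} ∪
  {t | ∃ u v w x : D,
      t = (2 : K)⁻¹ • (wedge2 u v ⊗ₜ[K] wedge2 w x + wedge2 u w ⊗ₜ[K] wedge2 v x)}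

/-- Over a field of characteristic different from two, the kernel of `⋀²D ⊗ ⋀²D → ⋀⁴D` is
spanned by antisymmetric tensors and the elements `½(u∧v ⊗ w∧x + u∧w ⊗ v∧x)`. -/
theorem ker_wedgeMul {K : Type*} [Field K] (h2 : (2 : K) ≠ 0) (D : Type*) [AddCommGroup D]
    [Module K D] :
    LinearMap.ker (wedgeMul K D) =
      Submodule.span K (wedgeRelations K D) := by
  set N := Submodule.span K (wedgeRelations K D) with hN
  refine le_antisymm ?_ ?_
  · let _ : AddCommGroup ((⋀[K]^2 D) ⊗[K] (⋀[K]^2 D)) := Module.addCommMonoidToAddCommGroup K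
    have hswap (u v w x : D) : N.mkQ (wedge2 u v ⊗ₜ wedge2 w x) =
        -N.mkQ (wedge2 u w ⊗ₜ wedge2 v x) := by
      refine eq_neg_of_add_eq_zero_left ?_
      rw [← map_add, Submodule.mkQ_apply, Submodule.Quotient.mk_eq_zero]
      have := N.smul_mem 2 (Submodule.subset_span (Or.inr ⟨u, v, w, x, rfl⟩))
      rwa [smul_inv_smul₀ h2] at this
    have hself (u v x : D) : N.mkQ (wedge2 u v ⊗ₜ wedge2 v x) = 0 := by
      have h := eq_neg_iff_add_eq_zero.mp (hswap u v v x)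
      rw [← two_smul K] at h
      exact (smul_eq_zero.mp h).resolve_left h2
    let s := liftAlternating (R := K)
      (Function.update 0 4 (alternatingOfSelf N.mkQ hself))
    have hs : s ∘ₗ wedgeMul K D = N.mkQ := by
      refine TensorProduct.ext (bilin_ext_wedge2 fun u v w x => ?_)
      have e : wedgeMul K D (wedge2 u v ⊗ₜ wedge2 w x) = ιMulti K 4 ![u, v, w, x] := by
        simp [coe_wedge2, ιMulti_apply, mul_assoc]
      change s (wedgeMul K D (wedge2 u v ⊗ₜ wedge2 w x)) = N.mkQ (wedge2 u v ⊗ₜ wedge2 w x)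
      rw [e, liftAlternating_apply_ιMulti, Function.update_self]
      exact mapWedge2Tmul_apply N.mkQ ![u, v, w, x]
    rw [← N.ker_mkQ, ← hs]
    exact LinearMap.ker_le_ker_comp _ _
  · rw [hN, Submodule.span_le]
    rintro _ (⟨a, b, rfl⟩ | ⟨u, v, w, x, rfl⟩)
    · simp [mul_comm_of_exteriorPower_two a b]
    · simp only [SetLike.mem_coe, LinearMap.mem_ker, map_smul, map_add, wedgeMul_tmul,
        wedge2_mul_add_swap, smul_zero]

/-- Let `p` be an odd prime and `U` a finite-dimensional `𝔽_p`-vector space, with dual `D`.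
The kernel of the multiplication map `S²(Λ²U^∨) → Λ⁴U^∨` is generated by the elements
`½(u∧v · w∧x + u∧w · v∧x)` for `u,v,w,x ∈ U^∨`.  Realizing `S²(Λ²U^∨)` as the quotient of
`Λ²U^∨ ⊗ Λ²U^∨` by the antisymmetric tensors, this says precisely that the kernel of the
wedge multiplication `Λ²U^∨ ⊗ Λ²U^∨ → Λ⁴U^∨` is spanned by the antisymmetric tensors
`a ⊗ b − b ⊗ a` together with the lifts `½(u∧v ⊗ w∧x + u∧w ⊗ v∧x)`. -/
theorem stmt4 (p : ℕ) [Fact p.Prime] (hodd : Odd p)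
    (U : Type) [AddCommGroup U] [Module (ZMod p) U] [FiniteDimensional (ZMod p) U] :
    LinearMap.ker (wedgeMul (ZMod p) (Module.Dual (ZMod p) U)) =
      Submodule.span (ZMod p)
        ({t | ∃ a b : (⋀[ZMod p]^2 (Module.Dual (ZMod p) U) :
            Submodule (ZMod p) (ExteriorAlgebra (ZMod p) (Module.Dual (ZMod p) U))),
            t = a ⊗ₜ[ZMod p] b - b ⊗ₜ[ZMod p] a} ∪
         {t | ∃ u v w x : Module.Dual (ZMod p) U,
            t = (2 : ZMod p)⁻¹ •
              (wedge2 u v ⊗ₜ[ZMod p] wedge2 w x + wedge2 u w ⊗ₜ[ZMod p] wedge2 v x)}) := by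
  refine ker_wedgeMul (fun h => ?_) _
  have hp : p ∣ 2 := (ZMod.natCast_eq_zero_iff 2 p).mp (by exact_mod_cast h)
  have := (Nat.prime_dvd_prime_iff_eq Fact.out Nat.prime_two).mp hp
  subst this
  exact absurd hodd (by decide)
end

section
/- Let p be an odd prime and T the Heisenberg group of order p³ with H = ⟨B,[A,B]⟩ as above. Then for any character χ ∈ H¹(H, Q/Z), writing χ = a·e₁^∨ + b·e₂^∨, one has Cores_H^T(χ ∪ χ) = b²·Cores_H^T(e₂^∨ ∪ e₂^∨), and this class lies in the second filtration step F²H³(T, Q/Z) of the Hochschild–Serre spectral sequence for T/[T,T] but not in F³H³(T,Q/Z) = Inf(H³(T/[T,T], Q/Z)) when b ≠ 0. -/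
open scoped BigOperators Classical

/-- The group `ℚ/ℤ`. -/
abbrev QZ : Type := AddCircle (1 : ℚ)

/-- The differential on inhomogeneous group cochains with trivial coefficients in `ℚ/ℤ`. -/
noncomputable def cochainD {G : Type*} [Group G] {n : ℕ} (f : (Fin n → G) → QZ) :
    (Fin (n + 1) → G) → QZ := fun g =>
  f (fun i => g i.succ) +
    (∑ i : Fin n, ((-1 : ℤ) ^ ((i : ℕ) + 1)) •
      f (fun j => if (j : ℕ) < (i : ℕ) then g (Fin.castSucc j)
        else if (j : ℕ) = (i : ℕ) then g (Fin.castSucc j) * g j.succ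
        else g j.succ)) +
    ((-1 : ℤ) ^ (n + 1)) • f (fun i => g (Fin.castSucc i))

/-- A cochain is a cocycle if its differential vanishes. -/
noncomputable def IsCocycle {G : Type*} [Group G] {n : ℕ} (f : (Fin n → G) → QZ) : Prop :=
  cochainD f = 0

/-- A cochain is a coboundary if it is the differential of a cochain of one degree lower
(in degree `0` this means that it vanishes). -/
noncomputable def IsCoboundary {G : Type*} [Group G] : {n : ℕ} → ((Fin n → G) → QZ) → Prop
  | 0, f => f = 0
  | (_ + 1), f => ∃ h, cochainD h = f

/-- Extension by zero of a cochain on a subgroup to a cochain on the ambient group. -/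
noncomputable def restrictTo {G : Type*} [Group G] (H : Subgroup G) {n : ℕ}
    (f : (Fin n → H) → QZ) : (Fin n → G) → QZ := fun g =>
  if h : ∀ i, g i ∈ H then f (fun i => ⟨g i, h i⟩) else 0

/-- The transfer (corestriction) of an inhomogeneous cochain on a subgroup `H` of `G`
along a section `σ` of the space of right cosets of `H` in `G`. -/
noncomputable def transfer {G : Type*} [Group G] (H : Subgroup G)
    (σ : Quotient (QuotientGroup.rightRel H) → G) {n : ℕ}
    (f : (Fin n → H) → QZ) : (Fin n → G) → QZ := fun g =>
  ∑ᶠ x : Quotient (QuotientGroup.rightRel H),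
    restrictTo H f (fun i =>
      σ (Quotient.mk (QuotientGroup.rightRel H) (σ x * ((List.ofFn g).take i).prod))
        * g i *
      (σ (Quotient.mk (QuotientGroup.rightRel H)
          (σ x * ((List.ofFn g).take ((i : ℕ) + 1)).prod)))⁻¹)

/-- `σ` is a section of the right coset space. -/
def IsSection {G : Type*} [Group G] (H : Subgroup G)
    (σ : Quotient (QuotientGroup.rightRel H) → G) : Prop :=
  ∀ x, Quotient.mk (QuotientGroup.rightRel H) (σ x) = x

/-- Additive characters with values in `ℚ/ℤ`. -/
def IsChar {G : Type*} [Group G] (χ : G → QZ) : Prop :=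
  ∀ a b, χ (a * b) = χ a + χ b

/-- The explicit 3-cocycle representing the cup product `χ ∪ χ'` of two degree-one classes,
written in terms of rational lifts `a` of `χ` and `b` of `χ'`. -/
noncomputable def cup3 {H : Type*} [Group H] (a b : H → ℚ) : (Fin 3 → H) → QZ := fun g =>
  (((a (g 0) + a (g 1) - a (g 0 * g 1)) * b (g 2) : ℚ) : QZ)

/-- The Hochschild–Serre filtration on cochains: `f` lies in filtration `p` with respect to a
normal subgroup `K` if it is invariant under translating its last `p` arguments by `K`. -/
def inFilt {G : Type*} [Group G] (K : Subgroup G) (p : ℕ) {n : ℕ}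
    (f : (Fin n → G) → QZ) : Prop :=
  ∀ (g κ : Fin n → G), (∀ i, κ i ∈ K) → (∀ i : Fin n, (i : ℕ) < n - p → κ i = 1) →
    f (fun i => g i * κ i) = f g

/-- The Heisenberg group of order `p³`: triples `(a,b,c)` over `ℤ/p` with
`(a,b,c)·(a',b',c') = (a+a', b+b', c+c'+ab')`.  It is generated by `A = (1,0,0)` and
`B = (0,1,0)`, with `[A,B] = (0,0,1)`, and satisfies the relations
`A^p = B^p = [A,B]^p = [A,[A,B]] = [B,[A,B]] = 1`. -/
def Heis (p : ℕ) : Type := ZMod p × ZMod p × ZMod p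

namespace Heis

variable {p : ℕ}

private def hmul (x y : Heis p) : Heis p :=
  (x.1 + y.1, x.2.1 + y.2.1, x.2.2 + y.2.2 + x.1 * y.2.1)

private def hinv (x : Heis p) : Heis p := (-x.1, -x.2.1, -x.2.2 + x.1 * x.2.1)

instance : Group (Heis p) where
  mul := hmul
  one := ((0 : ZMod p), (0 : ZMod p), (0 : ZMod p))
  inv := hinv
  mul_assoc a b c := by
    show hmul (hmul a b) c = hmul a (hmul b c)
    simp only [hmul]
    exact Prod.ext (by ring) (Prod.ext (by ring) (by ring))
  one_mul a := by
    show hmul (0, 0, 0) a = a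
    simp only [hmul]
    exact Prod.ext (by simp) (Prod.ext (by simp) (by simp))
  mul_one a := by
    show hmul a (0, 0, 0) = a
    simp only [hmul]
    exact Prod.ext (by simp) (Prod.ext (by simp) (by simp))
  inv_mul_cancel a := by
    show hmul (hinv a) a = (0, 0, 0)
    simp only [hmul, hinv]
    exact Prod.ext (by ring) (Prod.ext (by ring) (by ring))

/-- The subgroup `H = ⟨B, [A,B]⟩ = {(0,b,c)} ≅ (ℤ/p)²` of the Heisenberg group. -/
def Hsub (p : ℕ) : Subgroup (Heis p) where
  carrier := {x | x.1 = 0}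
  mul_mem' := by
    intro a b (ha : a.1 = 0) (hb : b.1 = 0)
    show a.1 + b.1 = 0
    simp [ha, hb]
  one_mem' := rfl
  inv_mem' := by
    intro a (ha : a.1 = 0)
    show -a.1 = 0
    simp [ha]

end Heis

namespace Heis

/-- The center/commutator subgroup `I = [T,T] = {(0,0,c)}` of the Heisenberg group. -/
def Zc (p : ℕ) : Subgroup (Heis p) where
  carrier := {x | x.1 = 0 ∧ x.2.1 = 0}
  mul_mem' := by
    rintro a b ⟨ha1, ha2⟩ ⟨hb1, hb2⟩
    exact ⟨by show a.1 + b.1 = 0; simp [ha1, hb1],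
      by show a.2.1 + b.2.1 = 0; simp [ha2, hb2]⟩
  one_mem' := ⟨rfl, rfl⟩
  inv_mem' := by
    rintro a ⟨ha1, ha2⟩
    exact ⟨by show -a.1 = 0; simp [ha1], by show -a.2.1 = 0; simp [ha2]⟩

end Heis

/-- The rational lift of the character `e₂^∨ : (0,b,c) ↦ c/p` of `H = ⟨B,[A,B]⟩`. -/
noncomputable def l2 {p : ℕ} (h : Heis.Hsub p) : ℚ := ((h : Heis p).2.2.val : ℚ) / p

/-- The rational lift of the character `χ = a·e₁^∨ + b·e₂^∨` of `H = ⟨B,[A,B]⟩`. -/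
noncomputable def lchi {p : ℕ} (a b : ZMod p) (h : Heis.Hsub p) : ℚ :=
  (((a * (h : Heis p).2.1 + b * (h : Heis p).2.2 : ZMod p)).val : ℚ) / p

section Cochains

variable {G : Type*} [Group G]

/-- The differential on `2`-cochains, in curried form. -/
def cobd2 : (G → G → QZ) →+ (G → G → G → QZ) where
  toFun h x y z := h y z - h (x * y) z + h x (y * z) - h x y
  map_zero' := by funext x y z; simp
  map_add' h h' := by funext x y z; simp only [Pi.add_apply]; abel

/-- The differential on `3`-cochains, in curried form. -/
def cobd3 : (G → G → G → QZ) →+ (G → G → G → G → QZ) where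
  toFun f x y z w := f y z w - f (x * y) z w + f x (y * z) w - f x y (z * w) + f x y z
  map_zero' := by funext x y z w; simp
  map_add' f f' := by funext x y z w; simp only [Pi.add_apply]; abel

lemma cobd2_apply (h : G → G → QZ) (x y z : G) :
    cobd2 h x y z = h y z - h (x * y) z + h x (y * z) - h x y := rfl

lemma cobd3_apply (f : G → G → G → QZ) (x y z w : G) :
    cobd3 f x y z w =
      f y z w - f (x * y) z w + f x (y * z) w - f x y (z * w) + f x y z := rfl

lemma cobd3_cobd2 (h : G → G → QZ) : cobd3 (cobd2 h) = 0 := by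
  funext x y z w
  simp only [cobd3_apply, cobd2_apply, mul_assoc, Pi.zero_apply]
  abel

lemma fin_three_eta {G : Type*} (g : Fin 3 → G) : ![g 0, g 1, g 2] = g := by
  funext i; fin_cases i <;> rfl

lemma cochainD_two (h : (Fin 2 → G) → QZ) (g : Fin 3 → G) :
    cochainD h g = cobd2 (fun x y => h ![x, y]) (g 0) (g 1) (g 2) := by
  have e0 : (fun i : Fin 2 => g i.succ) = ![g 1, g 2] := by
    funext i; fin_cases i <;> rfl
  have e1 : (fun j : Fin 2 => if (j : ℕ) < ((0 : Fin 2) : ℕ) then g (Fin.castSucc j)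
        else if (j : ℕ) = ((0 : Fin 2) : ℕ) then g (Fin.castSucc j) * g j.succ
        else g j.succ) = ![g 0 * g 1, g 2] := by
    funext i; fin_cases i <;> simp
  have e2 : (fun j : Fin 2 => if (j : ℕ) < ((1 : Fin 2) : ℕ) then g (Fin.castSucc j)
        else if (j : ℕ) = ((1 : Fin 2) : ℕ) then g (Fin.castSucc j) * g j.succ
        else g j.succ) = ![g 0, g 1 * g 2] := by
    funext i; fin_cases i <;> simp
  have e3 : (fun i : Fin 2 => g (Fin.castSucc i)) = ![g 0, g 1] := by
    funext i; fin_cases i <;> rfl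
  rw [cochainD, Fin.sum_univ_two, e0, e1, e2, e3, cobd2_apply]
  norm_num
  abel

lemma cochainD_three (f : (Fin 3 → G) → QZ) (g : Fin 4 → G) :
    cochainD f g = cobd3 (fun x y z => f ![x, y, z]) (g 0) (g 1) (g 2) (g 3) := by
  have e0 : (fun i : Fin 3 => g i.succ) = ![g 1, g 2, g 3] := by
    funext i; fin_cases i <;> rfl
  have e1 : (fun j : Fin 3 => if (j : ℕ) < ((0 : Fin 3) : ℕ) then g (Fin.castSucc j)
        else if (j : ℕ) = ((0 : Fin 3) : ℕ) then g (Fin.castSucc j) * g j.succ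
        else g j.succ) = ![g 0 * g 1, g 2, g 3] := by
    funext i; fin_cases i <;> simp
  have e2 : (fun j : Fin 3 => if (j : ℕ) < ((1 : Fin 3) : ℕ) then g (Fin.castSucc j)
        else if (j : ℕ) = ((1 : Fin 3) : ℕ) then g (Fin.castSucc j) * g j.succ
        else g j.succ) = ![g 0, g 1 * g 2, g 3] := by
    funext i; fin_cases i <;> simp
  have e3 : (fun j : Fin 3 => if (j : ℕ) < ((2 : Fin 3) : ℕ) then g (Fin.castSucc j)
        else if (j : ℕ) = ((2 : Fin 3) : ℕ) then g (Fin.castSucc j) * g j.succ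
        else g j.succ) = ![g 0, g 1, g 2 * g 3] := by
    funext i; fin_cases i <;> simp
  have e4 : (fun i : Fin 3 => g (Fin.castSucc i)) = ![g 0, g 1, g 2] := by
    funext i; fin_cases i <;> rfl
  rw [cochainD, Fin.sum_univ_three, e0, e1, e2, e3, e4, cobd3_apply]
  norm_num
  abel

lemma isCoboundary_iff (F : (Fin 3 → G) → QZ) :
    IsCoboundary F ↔ (fun x y z => F ![x, y, z]) ∈ (cobd2 (G := G)).range := by
  constructor
  · rintro ⟨h, rfl⟩
    refine ⟨fun x y => h ![x, y], ?_⟩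
    funext x y z
    rw [cochainD_two]; rfl
  · rintro ⟨h, hh⟩
    refine ⟨fun g => h (g 0) (g 1), ?_⟩
    funext g
    rw [cochainD_two, ← fin_three_eta g]
    exact congrFun (congrFun (congrFun hh (g 0)) (g 1)) (g 2)

lemma isCocycle_iff (F : (Fin 3 → G) → QZ) :
    IsCocycle F ↔ cobd3 (fun x y z => F ![x, y, z]) = 0 := by
  constructor
  · intro h
    funext x y z w
    have := congrFun h ![x, y, z, w]
    rw [cochainD_three] at this
    exact this
  · intro h
    funext g
    rw [cochainD_three, h]; rfl

/-- The cochain `δu ∪ v` modulo `1`, in curried form. -/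
def cupQ (u v : G → ℚ) (x y z : G) : QZ := (((u x + u y - u (x * y)) * v z : ℚ) : QZ)

lemma coe_eq_coe_of_int {q r : ℚ} (n : ℤ) (h : q = r + n) : (q : QZ) = (r : QZ) := by
  rw [← sub_eq_zero, ← AddCircle.coe_sub, AddCircle.coe_eq_zero_iff]
  exact ⟨n, by rw [h]; simp⟩

/-- A rational cochain that is a character modulo `ℤ`, with `δu` its integral boundary. -/
def IsCharLift (u : G → ℚ) (δ : G → G → ℤ) : Prop :=
  ∀ x y, u (x * y) = u x + u y - δ x y

lemma cobd3_cupQ {u v : G → ℚ} {δu δv : G → G → ℤ} (hu : IsCharLift u δu)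
    (hv : IsCharLift v δv) : cobd3 (cupQ u v) = 0 := by
  funext x y z w
  have key : (δu y z - δu (x * y) z + δu x (y * z) - δu x y : ℚ) = 0 := by
    have h1 := hu (x * y) z
    have h2 := hu x (y * z)
    rw [mul_assoc] at h1
    linarith [hu x y, hu y z]
  simp only [cobd3_apply, cupQ, ← AddCircle.coe_sub, ← AddCircle.coe_add, Pi.zero_apply,
    ← AddCircle.coe_zero]
  refine coe_eq_coe_of_int (δu x y * δv z w) ?_
  rw [hu x y, hu y z, hu (x * y) z, hu x (y * z), hv z w, hu x y, hu y z]
  push_cast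
  linear_combination (v w) * key

end Cochains

open scoped commutatorElement

namespace Heis

variable {p : ℕ}

@[ext] lemma ext {x y : Heis p} (h1 : x.1 = y.1) (h2 : x.2.1 = y.2.1) (h3 : x.2.2 = y.2.2) :
    x = y := Prod.ext h1 (Prod.ext h2 h3)

/-- The element of the Heisenberg group with given coordinates. -/
def mk (a b c : ZMod p) : Heis p := (a, b, c)

@[simp] lemma mk_fst (a b c : ZMod p) : (mk a b c).1 = a := rfl
@[simp] lemma mk_snd_fst (a b c : ZMod p) : (mk a b c).2.1 = b := rfl
@[simp] lemma mk_snd_snd (a b c : ZMod p) : (mk a b c).2.2 = c := rfl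
@[simp] lemma mul_fst (x y : Heis p) : (x * y).1 = x.1 + y.1 := rfl
@[simp] lemma mul_snd_fst (x y : Heis p) : (x * y).2.1 = x.2.1 + y.2.1 := rfl
@[simp] lemma mul_snd_snd (x y : Heis p) :
    (x * y).2.2 = x.2.2 + y.2.2 + x.1 * y.2.1 := rfl
@[simp] lemma inv_fst (x : Heis p) : (x⁻¹).1 = -x.1 := rfl
@[simp] lemma inv_snd_fst (x : Heis p) : (x⁻¹).2.1 = -x.2.1 := rfl
@[simp] lemma inv_snd_snd (x : Heis p) : (x⁻¹).2.2 = -x.2.2 + x.1 * x.2.1 := rfl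

lemma mem_Hsub {x : Heis p} : x ∈ Hsub p ↔ x.1 = 0 := Iff.rfl

lemma mem_Zc {x : Heis p} : x ∈ Zc p ↔ x.1 = 0 ∧ x.2.1 = 0 := Iff.rfl

@[simp] lemma Hsub_fst (h : Hsub p) : (h : Heis p).1 = 0 := h.2

lemma Zc_eq_commutator : Zc p = commutator (Heis p) := by
  apply le_antisymm
  · intro x hx
    have : x = ⁅mk x.2.2 0 0, mk 0 1 0⁆ := by
      rw [commutatorElement_def]
      ext <;> simp [(mem_Zc.1 hx).1, (mem_Zc.1 hx).2]
    rw [this]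
    exact Subgroup.commutator_mem_commutator (Subgroup.mem_top _) (Subgroup.mem_top _)
  · rw [commutator_def, Subgroup.commutator_le]
    intro g _ h _
    rw [mem_Zc, commutatorElement_def]
    constructor <;> simp

/-- A crossed family `k` of maps `T → H`, indexed by the cosets of `H`. -/
def IsCrossed (k : ZMod p → Heis p → Hsub p) : Prop :=
  ∀ x g g', k x (g * g') = k x g * k (x + g.1) g'

/-- The crossed family attached to the section `x ↦ (x, 0, 0)`. -/
def kStd (x : ZMod p) (g : Heis p) : Hsub p := ⟨mk 0 g.2.1 (g.2.2 + x * g.2.1), rfl⟩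

/-- The crossed family attached to a section `s` of the first coordinate. -/
def kOf (s : ZMod p → Heis p) (hs : ∀ x, (s x).1 = x) (x : ZMod p) (g : Heis p) : Hsub p :=
  ⟨s x * g * (s (x + g.1))⁻¹, by rw [mem_Hsub]; simp [hs]⟩

lemma isCrossed_kStd : IsCrossed (kStd (p := p)) := by
  intro x g g'
  apply Subtype.ext
  ext <;> simp [kStd]; ring

lemma isCrossed_kOf (s : ZMod p → Heis p) (hs : ∀ x, (s x).1 = x) : IsCrossed (kOf s hs) := by
  intro x g g'
  apply Subtype.ext
  simp only [kOf, Subgroup.coe_mul, mul_fst, ← add_assoc]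
  group

lemma rightRel_mk_eq {x y : Heis p} :
    (Quotient.mk (QuotientGroup.rightRel (Hsub p)) x = Quotient.mk _ y) ↔ x.1 = y.1 := by
  rw [Quotient.eq, QuotientGroup.rightRel_apply, mem_Hsub, mul_fst, inv_fst, ← sub_eq_add_neg,
    sub_eq_zero, eq_comm]

lemma restrictTo_coe {G : Type*} [Group G] (H : Subgroup G) {n : ℕ} (f : (Fin n → H) → QZ)
    (w : Fin n → H) : restrictTo H f (fun i => (w i : G)) = f w := by
  rw [restrictTo, dif_pos fun i => (w i).2]

variable [NeZero p]

/-- The transfer of `2`-cochains along a crossed family. -/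
def tr2 (k : ZMod p → Heis p → Hsub p) (f : Hsub p → Hsub p → QZ) (g h : Heis p) : QZ :=
  ∑ x : ZMod p, f (k x g) (k (x + g.1) h)

/-- The transfer of `3`-cochains along a crossed family. -/
def tr3 (k : ZMod p → Heis p → Hsub p) :
    (Hsub p → Hsub p → Hsub p → QZ) →+ (Heis p → Heis p → Heis p → QZ) where
  toFun f g h j := ∑ x : ZMod p, f (k x g) (k (x + g.1) h) (k (x + g.1 + h.1) j)
  map_zero' := by funext g h j; simp
  map_add' f f' := by funext g h j; simp [Finset.sum_add_distrib]

lemma tr3_apply (k : ZMod p → Heis p → Hsub p) (f : Hsub p → Hsub p → Hsub p → QZ)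
    (g h j : Heis p) :
    tr3 k f g h j = ∑ x : ZMod p, f (k x g) (k (x + g.1) h) (k (x + g.1 + h.1) j) := rfl

lemma sum_shift {M : Type*} [AddCommMonoid M] (F : ZMod p → M) (a : ZMod p) :
    ∑ x, F x = ∑ x, F (x + a) :=
  (Equiv.sum_comp (Equiv.addRight a) F).symm

lemma tr3_cobd2 {k : ZMod p → Heis p → Hsub p} (hk : IsCrossed k)
    (h : Hsub p → Hsub p → QZ) : tr3 k (cobd2 h) = cobd2 (tr2 k h) := by
  funext x y z
  rw [tr3_apply, cobd2_apply, tr2, tr2, tr2, tr2,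
    sum_shift (fun t => h (k t y) (k (t + y.1) z)) x.1,
    ← Finset.sum_sub_distrib, ← Finset.sum_add_distrib, ← Finset.sum_sub_distrib]
  refine Finset.sum_congr rfl fun t _ => ?_
  simp only [cobd2_apply, hk _ _ _, mul_fst, add_assoc]

lemma cobd3_tr3 {k : ZMod p → Heis p → Hsub p} (hk : IsCrossed k)
    {f : Hsub p → Hsub p → Hsub p → QZ} (hf : cobd3 f = 0) : cobd3 (tr3 k f) = 0 := by
  funext x y z w
  rw [cobd3_apply, tr3_apply, tr3_apply, tr3_apply, tr3_apply, tr3_apply,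
    sum_shift (fun t => f (k t y) (k (t + y.1) z) (k (t + y.1 + z.1) w)) x.1,
    ← Finset.sum_sub_distrib, ← Finset.sum_add_distrib, ← Finset.sum_sub_distrib,
    ← Finset.sum_add_distrib]
  refine Finset.sum_eq_zero fun t _ => ?_
  have := congrFun (congrFun (congrFun (congrFun hf (k t x)) (k (t + x.1) y))
    (k (t + x.1 + y.1) z)) (k (t + x.1 + y.1 + z.1) w)
  rw [cobd3_apply] at this
  simp only [hk _ _ _, mul_fst, add_assoc] at this ⊢
  exact this

lemma tr3_sub_mem {k k' : ZMod p → Heis p → Hsub p} (hk : IsCrossed k) (hk' : IsCrossed k')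
    (η : ZMod p → Hsub p) (hη : ∀ x g, η x * k x g = k' x g * η (x + g.1))
    {f : Hsub p → Hsub p → Hsub p → QZ} (hf : cobd3 f = 0) :
    tr3 k' f - tr3 k f ∈ (cobd2 (G := Heis p)).range := by
  let K : ZMod p → Heis p → Heis p → QZ := fun t x y =>
    f (η t) (k t x) (k (t + x.1) y) - f (k' t x) (η (t + x.1)) (k (t + x.1) y)
      + f (k' t x) (k' (t + x.1) y) (η (t + x.1 + y.1))
  refine ⟨-fun x y => ∑ t, K t x y, ?_⟩
  funext x y z
  rw [map_neg]
  simp only [Pi.neg_apply, Pi.sub_apply, cobd2_apply, tr3_apply]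
  rw [sum_shift (fun t => K t y z) x.1,
    ← Finset.sum_sub_distrib, ← Finset.sum_add_distrib, ← Finset.sum_sub_distrib,
    ← Finset.sum_neg_distrib, ← Finset.sum_sub_distrib]
  refine Finset.sum_congr rfl fun t _ => ?_
  have R (a b c d : Hsub p) := congrFun (congrFun (congrFun (congrFun hf a) b) c) d
  have R0 := R (η t) (k t x) (k (t + x.1) y) (k (t + x.1 + y.1) z)
  have R1 := R (k' t x) (η (t + x.1)) (k (t + x.1) y) (k (t + x.1 + y.1) z)
  have R2 := R (k' t x) (k' (t + x.1) y) (η (t + x.1 + y.1)) (k (t + x.1 + y.1) z)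
  have R3 := R (k' t x) (k' (t + x.1) y) (k' (t + x.1 + y.1) z) (η (t + x.1 + y.1 + z.1))
  simp only [cobd3_apply, hη, Pi.zero_apply] at R0 R1 R2 R3
  simp only [K, hk _ _ _, hk' _ _ _, mul_fst, ← add_assoc]
  have := congrArg₂ (· - ·) (congrArg₂ (· + ·) (congrArg₂ (· - ·) R0 R1) R2) R3
  simp only [sub_zero, add_zero] at this
  rw [← sub_eq_zero, ← this]
  abel

lemma tr3_kOf_sub_mem (s : ZMod p → Heis p) (hs : ∀ x, (s x).1 = x)
    {f : Hsub p → Hsub p → Hsub p → QZ} (hf : cobd3 f = 0) :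
    tr3 (kOf s hs) f - tr3 kStd f ∈ (cobd2 (G := Heis p)).range := by
  refine tr3_sub_mem isCrossed_kStd (isCrossed_kOf s hs)
    (fun x => ⟨s x * (mk x 0 0)⁻¹, by rw [mem_Hsub]; simp [hs]⟩) (fun x g => ?_) hf
  apply Subtype.ext
  ext <;> simp [kOf, kStd, hs]; ring

lemma transfer_eq_tr3 (σ : Quotient (QuotientGroup.rightRel (Hsub p)) → Heis p)
    (s : ZMod p → Heis p) (hs : ∀ x, (s x).1 = x)
    (hsσ : ∀ g : Heis p, σ (Quotient.mk _ g) = s g.1)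
    (f : (Fin 3 → Hsub p) → QZ) (x y z : Heis p) :
    transfer (Hsub p) σ f ![x, y, z] = tr3 (kOf s hs) (fun a b c => f ![a, b, c]) x y z := by
  have hb : Function.Bijective
      (fun t : ZMod p => Quotient.mk (QuotientGroup.rightRel (Hsub p)) (mk t 0 0)) := by
    constructor
    · intro a b h
      simpa using rightRel_mk_eq.1 h
    · intro q
      induction q using Quotient.inductionOn with
      | h g => exact ⟨g.1, rightRel_mk_eq.2 rfl⟩
  rw [transfer, ← finsum_eq_of_bijective _ hb (fun t => rfl), finsum_eq_sum_of_fintype, tr3_apply]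
  refine Finset.sum_congr rfl fun t _ => ?_
  refine Eq.trans (congrArg _ (funext fun i => ?_)) (restrictTo_coe _ f _)
  fin_cases i <;> simp [hsσ, kOf, hs, add_assoc]

end Heis

section Fractions

variable {p : ℕ}

/-- The representative in `[0, 1)` of the class `t / p`. -/
def lq (t : ZMod p) : ℚ := (t.val : ℚ) / p

lemma coe_sum {ι : Type*} (s : Finset ι) (F : ι → ℚ) :
    ∑ i ∈ s, ((F i : ℚ) : QZ) = ((∑ i ∈ s, F i : ℚ) : QZ) :=
  (map_sum (QuotientAddGroup.mk' (AddSubgroup.zmultiples (1 : ℚ))) F s).symm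

lemma coe_int (n : ℤ) : (((n : ℤ) : ℚ) : QZ) = 0 := by
  rw [AddCircle.coe_eq_zero_iff]; exact ⟨n, by simp⟩

lemma coe_nsmul (n : ℕ) (q : ℚ) : n • ((q : ℚ) : QZ) = ((n * q : ℚ) : QZ) := by
  rw [← AddCircle.coe_nsmul, nsmul_eq_mul]

@[simp] lemma lq_zero : lq (0 : ZMod p) = 0 := by simp [lq]

variable [NeZero p]

lemma lq_natCast (n : ℕ) : ∃ k : ℤ, lq (n : ZMod p) = n / p + k := by
  refine ⟨-(n / p : ℕ), ?_⟩
  have hp : (p : ℚ) ≠ 0 := NeZero.ne _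
  have h : (n : ℚ) = p * (n / p : ℕ) + (n % p : ℕ) := by exact_mod_cast (Nat.div_add_mod n p).symm
  rw [lq, ZMod.val_natCast]
  generalize n / p = q at h ⊢
  push_cast
  field_simp
  linarith

lemma lq_linear (a b s t : ZMod p) :
    ∃ k : ℤ, lq (a * s + b * t) = a.val * lq s + b.val * lq t + k := by
  obtain ⟨k, hk⟩ := lq_natCast (p := p) (a.val * s.val + b.val * t.val)
  refine ⟨k, ?_⟩
  simp only [Nat.cast_add, Nat.cast_mul, ZMod.natCast_zmod_val] at hk
  rw [hk, lq, lq]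
  ring

lemma lq_add (s t : ZMod p) : ∃ k : ℤ, lq (s + t) = lq s + lq t - k := by
  obtain ⟨k, hk⟩ := lq_natCast (p := p) (s.val + t.val)
  refine ⟨-k, ?_⟩
  simp only [Nat.cast_add, ZMod.natCast_zmod_val] at hk
  rw [hk, lq, lq]
  push_cast
  ring

lemma card_mul_lq (t : ZMod p) : (p : ℚ) * lq t = t.val :=
  mul_div_cancel₀ _ (NeZero.ne _)

lemma sum_val : ∑ t : ZMod p, t.val = ∑ k ∈ Finset.range p, k :=
  Finset.sum_nbij' (fun t => t.val) (fun k => (k : ZMod p))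
    (fun t _ => Finset.mem_range.2 t.val_lt) (fun _ _ => Finset.mem_univ _)
    (fun t _ => ZMod.natCast_zmod_val t)
    (fun _ hk => ZMod.val_cast_of_lt (Finset.mem_range.1 hk)) (fun _ _ => rfl)

lemma sum_lq (hodd : Odd p) : ∃ n : ℤ, ∑ t : ZMod p, lq t = n := by
  obtain ⟨m, hm⟩ := hodd
  refine ⟨m, ?_⟩
  have hp : (p : ℚ) ≠ 0 := NeZero.ne _
  have h := Finset.sum_range_id_mul_two p
  rw [← sum_val] at h
  have h' : (∑ t : ZMod p, (t.val : ℚ)) * 2 = p * (p - 1 : ℕ) := by exact_mod_cast h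
  have hm' : ((p - 1 : ℕ) : ℚ) = 2 * m := by rw [hm]; push_cast; simp
  simp only [lq]
  rw [← Finset.sum_div, div_eq_iff hp]
  rw [hm'] at h'
  push_cast
  linarith

lemma sum_lq_affine (hp : p.Prime) (hodd : Odd p) (c b : ZMod p) :
    ∃ n : ℤ, ∑ x : ZMod p, lq (c + x * b) = n := by
  have := Fact.mk hp
  by_cases hb : b = 0
  · refine ⟨c.val, ?_⟩
    simp [hb, card_mul_lq, ZMod.card]
  · obtain ⟨n, hn⟩ := sum_lq hodd
    refine ⟨n, ?_⟩
    rw [← hn]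
    exact Equiv.sum_comp ((Equiv.mulRight₀ b hb).trans (Equiv.addLeft c)) lq

end Fractions

namespace Heis

variable {p : ℕ}

lemma mk_mul_mk (a b c a' b' c' : ZMod p) :
    mk a b c * mk a' b' c' = mk (a + a') (b + b') (c + c' + a * b') := rfl

lemma fst_mul_Zc (g : Heis p) {z : Heis p} (hz : z ∈ Zc p) : (g * z).1 = g.1 := by
  simp [(mem_Zc.1 hz).1]

lemma snd_fst_mul_Zc (g : Heis p) {z : Heis p} (hz : z ∈ Zc p) : (g * z).2.1 = g.2.1 := by
  simp [(mem_Zc.1 hz).2]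

/-- Evaluation of a `3`-cochain on the fundamental cycle of the Heisenberg nilmanifold. -/
def evalCycle : (Heis p → Heis p → Heis p → QZ) →+ QZ where
  toFun f := f (mk 1 0 0) (mk 0 1 0) (mk 0 0 1) - f (mk 0 1 1) (mk 1 0 0) (mk 0 0 1)
    + f (mk 0 1 1) (mk 0 0 1) (mk 1 0 0) - f (mk 1 0 0) (mk 0 0 1) (mk 0 1 0)
    + f (mk 0 0 1) (mk 1 0 0) (mk 0 1 0) - f (mk 0 0 1) (mk 0 1 1) (mk 1 0 0)
    - f (mk 0 0 1) (mk 0 1 0) (mk 0 0 1)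
  map_zero' := by simp
  map_add' f f' := by simp only [Pi.add_apply]; abel

lemma evalCycle_apply (f : Heis p → Heis p → Heis p → QZ) :
    evalCycle f = f (mk 1 0 0) (mk 0 1 0) (mk 0 0 1) - f (mk 0 1 1) (mk 1 0 0) (mk 0 0 1)
    + f (mk 0 1 1) (mk 0 0 1) (mk 1 0 0) - f (mk 1 0 0) (mk 0 0 1) (mk 0 1 0)
    + f (mk 0 0 1) (mk 1 0 0) (mk 0 1 0) - f (mk 0 0 1) (mk 0 1 1) (mk 1 0 0)
    - f (mk 0 0 1) (mk 0 1 0) (mk 0 0 1) := rfl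

lemma evalCycle_cobd2 (h : Heis p → Heis p → QZ) : evalCycle (cobd2 h) = 0 := by
  simp only [evalCycle_apply, cobd2_apply, mk_mul_mk, add_zero, zero_add, mul_zero, mul_one]
  abel

lemma evalCycle_inflated {f : Heis p → Heis p → Heis p → QZ} (hf : cobd3 f = 0)
    (F : ZMod p → ZMod p → ZMod p → ZMod p → ZMod p → ZMod p → QZ)
    (hF : ∀ a b c a' b' c' a'' b'' c'',
      f (mk a b c) (mk a' b' c') (mk a'' b'' c'') = F a b a' b' a'' b'') : evalCycle f = 0 := by
  have R (x y z w : Heis p) := congrFun (congrFun (congrFun (congrFun hf x) y) z) w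
  let A : Heis p := mk 1 0 0
  let B : Heis p := mk 0 1 0
  let E : Heis p := mk 0 0 0
  have r1 := R A B E E
  have r2 := R B A E E
  have r3 := R E E A B
  have r4 := R E E B A
  have r5 := R B E E A
  have r6 := R A E E B
  have r7 := R E E B E
  simp only [cobd3_apply, A, B, E, mk_mul_mk, hF, Pi.zero_apply, add_zero, zero_add]
    at r1 r2 r3 r4 r5 r6 r7
  have h := congrArg₂ (· - ·) (congrArg₂ (· + ·) (congrArg₂ (· - ·) (congrArg₂ (· - ·)
    (congrArg₂ (· + ·) (congrArg₂ (· - ·) r1 r2) r3) r4) r5) r6) r7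
  simp only [sub_zero, add_zero] at h
  rw [evalCycle_apply, ← h]
  simp only [hF]
  abel

variable [NeZero p]

lemma exists_isCharLift_lchi (a b : ZMod p) : ∃ δ, IsCharLift (lchi (p := p) a b) δ := by
  choose n hn using lq_add (p := p)
  refine ⟨fun x y => n (a * (x : Heis p).2.1 + b * (x : Heis p).2.2)
    (a * (y : Heis p).2.1 + b * (y : Heis p).2.2), fun x y => ?_⟩
  have h := hn (a * (x : Heis p).2.1 + b * (x : Heis p).2.2)
    (a * (y : Heis p).2.1 + b * (y : Heis p).2.2)
  simp only [lchi]
  rw [← lq, ← lq, ← lq, ← h]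
  congr 1
  simp
  ring

lemma l2_eq_lchi : (l2 : Hsub p → ℚ) = lchi 0 1 := by
  funext h
  simp [l2, lchi]

lemma tr3_kOf_cupQ_sub_mem (s : ZMod p → Heis p) (hs : ∀ x, (s x).1 = x) (a b : ZMod p) :
    tr3 (kOf s hs) (cupQ (lchi a b) (lchi a b)) - tr3 kStd (cupQ (lchi a b) (lchi a b)) ∈
      (cobd2 (G := Heis p)).range := by
  obtain ⟨δ, hδ⟩ := exists_isCharLift_lchi a b
  exact tr3_kOf_sub_mem s hs (cobd3_cupQ hδ hδ)

/-- Only the square of the second coordinate contributes to the transfer of `χ ∪ χ`. -/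
lemma tr3_kStd_cupQ_lchi_sub_mem (hp : p.Prime) (hodd : Odd p) (a b : ZMod p) :
    tr3 kStd (cupQ (lchi a b) (lchi a b)) - (b.val * b.val) • tr3 kStd (cupQ l2 l2) ∈
      (cobd2 (G := Heis p)).range := by
  choose n hn using lq_add (p := p)
  choose k hk using lq_linear (p := p) a b
  choose S hS using sum_lq_affine hp hodd
  let β : Hsub p → ZMod p := fun x => (x : Heis p).2.1
  let γ : Hsub p → ZMod p := fun x => (x : Heis p).2.2
  have hβ x y : β (x * y) = β x + β y := rfl
  have hγ x y : γ (x * y) = γ x + γ y := by simp [γ]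
  let h : Hsub p → Hsub p → QZ := fun x y =>
    ((k (β x) (γ x) * (a.val * lq (β y) + b.val * lq (γ y))
      + a.val * b.val * lq (γ x) * lq (β y) : ℚ) : QZ)
  let R : Hsub p → Hsub p → Hsub p → QZ := fun x y z =>
    ((a.val * a.val * n (β x) (β y) * lq (β z) + a.val * b.val * n (β x) (β y) * lq (γ z)
      + a.val * b.val * lq (γ x) * n (β y) (β z) : ℚ) : QZ)
  have decomp : cupQ (lchi a b) (lchi a b) = (b.val * b.val) • cupQ l2 l2 + cobd2 h + R := by
    funext x y z
    have hl x : lchi a b x = lq (a * β x + b * γ x) := rfl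
    have hl2 x : l2 x = lq (γ x) := rfl
    simp only [Pi.add_apply, Pi.smul_apply, cobd2_apply, cupQ, h, R, coe_nsmul,
      ← AddCircle.coe_sub, ← AddCircle.coe_add]
    refine coe_eq_coe_of_int ((a.val * n (β x) (β y) + b.val * n (γ x) (γ y)
      + (k (β x) (γ x) + k (β y) (γ y) - k (β x + β y) (γ x + γ y))) * k (β z) (γ z)
      + k (β x) (γ x) * (a.val * n (β y) (β z) + b.val * n (γ y) (γ z))) ?_
    simp only [hl, hl2, hβ, hγ, hk, hn]
    push_cast
    ring
  have hR : tr3 kStd R = 0 := by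
    funext g0 g1 g2
    simp only [tr3_apply, R, kStd, β, γ, mk_snd_fst, mk_snd_snd, coe_sum, Pi.zero_apply]
    have key : ∑ x : ZMod p, ((a.val * a.val * n g0.2.1 g1.2.1 * lq g2.2.1
        + a.val * b.val * n g0.2.1 g1.2.1 * lq (g2.2.2 + (x + g0.1 + g1.1) * g2.2.1)
        + a.val * b.val * lq (g0.2.2 + x * g0.2.1) * n g1.2.1 g2.2.1 : ℚ)) =
        ((a.val * a.val * n g0.2.1 g1.2.1 * g2.2.1.val
        + a.val * b.val * n g0.2.1 g1.2.1 * S g2.2.2 g2.2.1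
        + a.val * b.val * S g0.2.2 g0.2.1 * n g1.2.1 g2.2.1 : ℤ) : ℚ) := by
      have e := sum_shift (fun x => lq (g2.2.2 + x * g2.2.1)) (g0.1 + g1.1)
      simp only [← add_assoc] at e
      push_cast
      simp only [Finset.sum_add_distrib, ← Finset.sum_mul, ← Finset.mul_sum, ← e, hS,
        Finset.sum_const, Finset.card_univ, ZMod.card, nsmul_eq_mul, ← card_mul_lq]
      ring
    rw [key, coe_int]
  refine ⟨tr2 kStd h, ?_⟩
  rw [decomp, map_add, map_add, hR, map_nsmul, tr3_cobd2 isCrossed_kStd]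
  abel

/-- A cocycle in the second filtration step representing the transfer of `e₂^∨ ∪ e₂^∨`. -/
def stdF2 (g₀ g₁ g₂ : Heis p) : QZ :=
  ((∑ x : ZMod p, lq (g₀.2.2 + x * g₀.2.1) *
      (lq ((x + g₀.1) * g₁.2.1) + lq ((x + g₀.1 + g₁.1) * g₂.2.1)
        - lq ((x + g₀.1) * (g₁.2.1 + g₂.2.1)))
    - (∑ x : ZMod p, lq (g₀.2.2 + x * g₀.2.1)) * lq (g₁.1 * g₂.2.1) : ℚ) : QZ)

lemma tr3_kStd_cupQ_l2_sub_mem (hp : p.Prime) (hodd : Odd p) :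
    tr3 kStd (cupQ l2 l2) - stdF2 ∈ (cobd2 (G := Heis p)).range := by
  choose n hn using lq_add (p := p)
  choose S hS using sum_lq_affine hp hodd
  refine ⟨fun g g' => ((∑ x : ZMod p, lq (g.2.2 + x * g.2.1) *
    (lq ((x + g.1) * g'.2.1) + lq g'.2.2) : ℚ) : QZ), ?_⟩
  rw [eq_sub_iff_add_eq, eq_comm]
  funext g₀ g₁ g₂
  obtain ⟨a₀, b₀, c₀, rfl⟩ : ∃ a b c, g₀ = mk a b c := ⟨_, _, _, rfl⟩
  obtain ⟨a₁, b₁, c₁, rfl⟩ : ∃ a b c, g₁ = mk a b c := ⟨_, _, _, rfl⟩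
  obtain ⟨a₂, b₂, c₂, rfl⟩ : ∃ a b c, g₂ = mk a b c := ⟨_, _, _, rfl⟩
  have hl2 (x : ZMod p) (g : Heis p) : l2 (kStd x g) = lq (g.2.2 + x * g.2.1) := rfl
  have hl2m (x y : ZMod p) (g h : Heis p) :
      l2 (kStd x g * kStd y h) = lq (g.2.2 + x * g.2.1 + (h.2.2 + y * h.2.1)) := by
    simp [l2, kStd, lq]
  simp only [Pi.add_apply, cobd2_apply, tr3_apply, cupQ, stdF2, hl2, hl2m, coe_sum,
    ← AddCircle.coe_sub, ← AddCircle.coe_add, mk_mul_mk, mk_fst, mk_snd_fst, mk_snd_snd]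
  refine coe_eq_coe_of_int (-∑ x : ZMod p, n (c₀ + x * b₀) (c₁ + (x + a₀) * b₁)
      * n c₂ ((x + a₀ + a₁) * b₂) + S c₀ b₀ * (n c₁ c₂ + n (c₁ + c₂) (a₁ * b₂))) ?_
  rw [sum_shift (fun x => lq (c₁ + x * b₁) * (lq ((x + a₁) * b₂) + lq c₂)) a₀]
  push_cast
  rw [← hS, Finset.sum_mul, Finset.sum_mul, ← Finset.sum_sub_distrib, ← Finset.sum_sub_distrib,
    ← Finset.sum_add_distrib, ← Finset.sum_sub_distrib, ← Finset.sum_add_distrib,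
    ← Finset.sum_neg_distrib, ← Finset.sum_add_distrib, ← Finset.sum_add_distrib]
  refine Finset.sum_congr rfl fun x _ => ?_
  have e : c₀ + c₁ + a₀ * b₁ + x * (b₀ + b₁) = c₀ + x * b₀ + (c₁ + (x + a₀) * b₁) := by ring
  simp only [← add_assoc x a₀ a₁, e, hn]
  ring

lemma inFilt_stdF2 (N : ℕ) :
    inFilt (Zc p) 2 (fun g : Fin 3 → Heis p => (N • stdF2) (g 0) (g 1) (g 2)) := by
  intro g z hz h1
  have h0 : z 0 = 1 := h1 0 (by simp)
  simp only [Pi.smul_apply, stdF2, h0, mul_one, fst_mul_Zc _ (hz _), snd_fst_mul_Zc _ (hz _)]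

lemma evalCycle_stdF2 (hp : p.Prime) : evalCycle (stdF2 (p := p)) = ((-(1 / p) : ℚ) : QZ) := by
  have := Fact.mk hp
  have h1 : lq (1 : ZMod p) = 1 / p := by rw [lq, ZMod.val_one]; simp
  have e := sum_shift (fun x : ZMod p => lq x) 1
  have hp0 : (p : ℚ) ≠ 0 := NeZero.ne _
  simp [evalCycle_apply, stdF2]
  rw [coe_sum, ← Finset.mul_sum, Finset.sum_sub_distrib, ← e, sub_self, h1,
    mul_one_div_cancel hp0]
  simp

end Heis

/-- Let `p` be an odd prime, `T` the Heisenberg group of order `p³` and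
`H = ⟨B,[A,B]⟩` as before.  For any character `χ = a·e₁^∨ + b·e₂^∨` of `H` one has
`Cores_H^T(χ ∪ χ) = b²·Cores_H^T(e₂^∨ ∪ e₂^∨)`, and this class lies in the second
filtration step `F²H³(T, ℚ/ℤ)` of the Hochschild–Serre spectral sequence for
`I = [T,T]` (classes represented by cocycles invariant under `I`-translation of the last
two arguments) but, when `b ≠ 0`, not in
`F³H³(T, ℚ/ℤ) = Inf(H³(T/I, ℚ/ℤ))` (cocycles invariant under `I`-translation of all
three arguments, i.e. inflated from `T/I`). -/
theorem stmt10 (p : ℕ) (hp : p.Prime) (hodd : Odd p) (a b : ZMod p)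
    (σ : Quotient (QuotientGroup.rightRel (Heis.Hsub p)) → Heis p)
    (hσ : IsSection (Heis.Hsub p) σ) :
    Heis.Zc p = commutator (Heis p) ∧
    IsCoboundary (transfer (Heis.Hsub p) σ (cup3 (lchi a b) (lchi a b)) -
      (b.val * b.val) • transfer (Heis.Hsub p) σ (cup3 l2 l2)) ∧
    (∃ f' : (Fin 3 → Heis p) → QZ, IsCocycle f' ∧ inFilt (Heis.Zc p) 2 f' ∧
      IsCoboundary (transfer (Heis.Hsub p) σ (cup3 (lchi a b) (lchi a b)) - f')) ∧
    (b ≠ 0 → ¬ ∃ f' : (Fin 3 → Heis p) → QZ, IsCocycle f' ∧ inFilt (Heis.Zc p) 3 f' ∧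
      IsCoboundary (transfer (Heis.Hsub p) σ (cup3 (lchi a b) (lchi a b)) - f')) := by

  have : NeZero p := ⟨hp.ne_zero⟩
  let s : ZMod p → Heis p := fun x => σ (Quotient.mk _ (Heis.mk x 0 0))
  have hs x : (s x).1 = x := Heis.rightRel_mk_eq.1 (hσ _)
  have hsσ (g : Heis p) : σ (Quotient.mk _ g) = s g.1 :=
    congrArg σ (Heis.rightRel_mk_eq.2 rfl)
  have hτ (u : Heis.Hsub p → ℚ) :
      (fun x y z => transfer (Heis.Hsub p) σ (cup3 u u) ![x, y, z]) =
        Heis.tr3 (Heis.kOf s hs) (cupQ u u) := by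
    funext x y z
    exact Heis.transfer_eq_tr3 σ s hs hsσ _ x y z
  set N := b.val * b.val with hN
  have hχ := Heis.tr3_kOf_cupQ_sub_mem s hs a b
  have h2 := Heis.tr3_kOf_cupQ_sub_mem s hs (0 : ZMod p) 1
  rw [← Heis.l2_eq_lchi] at h2
  have hsq := Heis.tr3_kStd_cupQ_lchi_sub_mem hp hodd a b
  have hstd := Heis.tr3_kStd_cupQ_l2_sub_mem hp hodd
  have hF2 : Heis.tr3 (Heis.kOf s hs) (cupQ (lchi a b) (lchi a b)) - N • Heis.stdF2 ∈
      (cobd2 (G := Heis p)).range := by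
    convert add_mem (add_mem hχ hsq) (nsmul_mem hstd N) using 1
    rw [smul_sub]
    abel
  refine ⟨Heis.Zc_eq_commutator, ?_, ?_, ?_⟩
  · rw [isCoboundary_iff]
    convert sub_mem (add_mem hχ hsq) (nsmul_mem h2 N) using 1
    rw [← hτ, ← hτ, smul_sub]
    funext x y z
    simp only [Pi.sub_apply, Pi.add_apply, Pi.smul_apply]
    abel
  · refine ⟨fun g => (N • Heis.stdF2) (g 0) (g 1) (g 2), ?_, Heis.inFilt_stdF2 N, ?_⟩
    · obtain ⟨δ, hδ⟩ := Heis.exists_isCharLift_lchi a b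
      obtain ⟨h, hh⟩ := hF2
      rw [isCocycle_iff]
      have e : N • Heis.stdF2 =
          Heis.tr3 (Heis.kOf s hs) (cupQ (lchi a b) (lchi a b)) - cobd2 h := by
        rw [hh, sub_sub_cancel]
      change cobd3 (N • Heis.stdF2) = 0
      rw [e, map_sub, cobd3_cobd2,
        Heis.cobd3_tr3 (Heis.isCrossed_kOf s hs) (cobd3_cupQ hδ hδ), sub_zero]
    · rw [isCoboundary_iff]
      rw [← hτ] at hF2
      exact hF2
  · rintro hb ⟨f, hf, hinv, hcob⟩
    rw [isCoboundary_iff] at hcob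
    rw [isCocycle_iff] at hf
    have hinfl : Heis.evalCycle (fun x y z => f ![x, y, z]) = 0 := by
      refine Heis.evalCycle_inflated hf (fun a b a' b' a'' b'' =>
        f ![Heis.mk a b 0, Heis.mk a' b' 0, Heis.mk a'' b'' 0])
        fun a b c a' b' c' a'' b'' c'' => ?_
      rw [← hinv ![Heis.mk a b 0, Heis.mk a' b' 0, Heis.mk a'' b'' 0]
        ![Heis.mk 0 0 c, Heis.mk 0 0 c', Heis.mk 0 0 c'']
        (fun i => by fin_cases i <;> exact ⟨rfl, rfl⟩) (fun i hi => by simp at hi)]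
      congr 1
      funext i
      fin_cases i <;> simp [Heis.mk_mul_mk]
    have hev {F : Heis p → Heis p → Heis p → QZ} (hF : F ∈ (cobd2 (G := Heis p)).range) :
        Heis.evalCycle F = 0 := by
      obtain ⟨h, rfl⟩ := hF
      exact Heis.evalCycle_cobd2 h
    have e1 := hev hF2
    have e2 : Heis.evalCycle (Heis.tr3 (Heis.kOf s hs) (cupQ (lchi a b) (lchi a b)) -
        fun x y z => f ![x, y, z]) = 0 := by
      rw [← hτ]
      exact hev hcob
    rw [map_sub, hinfl, sub_zero] at e2
    rw [map_sub, e2, zero_sub, neg_eq_zero, map_nsmul, Heis.evalCycle_stdF2 hp, coe_nsmul,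
      AddCircle.coe_eq_zero_iff] at e1
    obtain ⟨m, hm⟩ := e1
    have hp0 : (p : ℚ) ≠ 0 := NeZero.ne _
    have hm' : (N : ℤ) = p * (-m) := by
      have : (N : ℚ) = p * (-m) := by
        rw [zsmul_eq_mul, mul_one] at hm
        rw [hm]
        field_simp
      exact_mod_cast this
    have hdvd : p ∣ b.val := by
      have h : p ∣ N := Int.natCast_dvd_natCast.1 ⟨-m, hm'⟩
      exact (hp.dvd_mul.1 h).elim id id
    exact hb ((ZMod.val_eq_zero b).1 (Nat.eq_zero_of_dvd_of_lt hdvd b.val_lt))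
end

section
/- Let p be an odd prime and G a finite group of exponent p which is a central extension of F_p-vector spaces 0 → V → G → U → 0 with V = [G,G] = Z(G) and dim U ≤ 5. Then every element of Λ³U can be written as u ∧ v with u ∈ U and v ∈ Λ²U; consequently the subgroup S³_dec of S³ = (V^∨ ∧ U^∨)^⊥ ⊆ Λ³U generated by decomposable-type elements u∧v equals S³ itself, so K³_max = K³. -/
open ExteriorAlgebra

set_option maxHeartbeats 1000000
set_option synthInstance.maxHeartbeats 400000

/-- The linear functional on the exterior algebra determined by an alternating `k`-form,
vanishing in all other degrees. -/
noncomputable def dualPiece {R U : Type*} [CommRing R] [AddCommGroup U] [Module R U]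
    (k : ℕ) (A : U [⋀^Fin k]→ₗ[R] R) : Module.Dual R (ExteriorAlgebra R U) :=
  ExteriorAlgebra.liftAlternating (fun i => if h : i = k then h.symm ▸ A else 0)

open scoped Matrix in
lemma exists_mulVec_eq_zero_of_transpose_eq_neg {F n : Type*} [Field F] (h2 : (2 : F) ≠ 0)
    [Fintype n] [DecidableEq n] (hn : Odd (Fintype.card n)) (M : Matrix n n F) (hM : Mᵀ = -M) :
    ∃ v ≠ 0, M *ᵥ v = 0 := by
  rw [Matrix.exists_mulVec_eq_zero_iff]
  have h : M.det = -M.det := by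
    conv_lhs => rw [← Matrix.det_transpose, hM, Matrix.det_neg, hn.neg_one_pow, neg_one_mul]
  exact (mul_eq_zero.1 (show 2 * M.det = 0 by linear_combination h)).resolve_left h2

lemma ι_mul_mem_exteriorPower_succ {R U : Type*} [CommRing R] [AddCommGroup U] [Module R U]
    {n : ℕ} (u : U) {x : ExteriorAlgebra R U} (hx : x ∈ ⋀[R]^n U) :
    ι R u * x ∈ ⋀[R]^(n + 1) U := by
  rw [exteriorPower, pow_succ']
  exact Submodule.mul_mem_mul ⟨u, rfl⟩ hx

lemma exteriorPower_succ_induction {R U : Type*} [CommRing R] [AddCommGroup U] [Module R U]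
    {n : ℕ} {P : ExteriorAlgebra R U → Prop}
    (hmul : ∀ u, ∀ x ∈ ⋀[R]^n U, P (ι R u * x)) (hadd : ∀ x y, P x → P y → P (x + y))
    {x : ExteriorAlgebra R U} (hx : x ∈ ⋀[R]^(n + 1) U) : P x := by
  rw [exteriorPower, pow_succ'] at hx
  refine Submodule.mul_induction_on hx ?_ hadd
  rintro _ ⟨u, rfl⟩ y hy
  exact hmul u y hy

lemma contractLeft_exteriorPower_zero {R U : Type*} [CommRing R] [AddCommGroup U] [Module R U]
    (f : Module.Dual R U) {x : ExteriorAlgebra R U} (hx : x ∈ ⋀[R]^0 U) :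
    CliffordAlgebra.contractLeft f x = 0 := by
  rw [exteriorPower, pow_zero] at hx
  obtain ⟨r, rfl⟩ := Submodule.mem_one.1 hx
  exact CliffordAlgebra.contractLeft_algebraMap _ _ r

lemma contractLeft_ι_mul' {R U : Type*} [CommRing R] [AddCommGroup U] [Module R U]
    (f : Module.Dual R U) (u : U) (x : ExteriorAlgebra R U) :
    CliffordAlgebra.contractLeft f (ι R u * x) =
      f u • x - ι R u * CliffordAlgebra.contractLeft f x :=
  CliffordAlgebra.contractLeft_ι_mul f u x

lemma contractLeft_mem_exteriorPower {R U : Type*} [CommRing R] [AddCommGroup U] [Module R U]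
    (f : Module.Dual R U) {n : ℕ} {x : ExteriorAlgebra R U} (hx : x ∈ ⋀[R]^(n + 1) U) :
    CliffordAlgebra.contractLeft f x ∈ ⋀[R]^n U := by
  induction n generalizing x with
  | zero =>
    refine exteriorPower_succ_induction (P := fun x => CliffordAlgebra.contractLeft f x ∈ ⋀[R]^0 U)
      (fun u y hy => ?_) (fun y z hy hz => ?_) hx
    · rw [contractLeft_ι_mul', contractLeft_exteriorPower_zero f hy, mul_zero, sub_zero]
      exact Submodule.smul_mem _ _ hy
    · rw [map_add]
      exact Submodule.add_mem _ hy hz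
  | succ n ih =>
    refine exteriorPower_succ_induction (P := fun x =>
      CliffordAlgebra.contractLeft f x ∈ ⋀[R]^(n + 1) U)
      (fun u y hy => ?_) (fun y z hy hz => ?_) hx
    · rw [contractLeft_ι_mul']
      exact Submodule.sub_mem _ (Submodule.smul_mem _ _ hy)
        (ι_mul_mem_exteriorPower_succ u (ih hy))
    · rw [map_add]
      exact Submodule.add_mem _ hy hz

/-- The Euler identity in the exterior algebra. -/
lemma sum_ι_mul_contractLeft {R U I : Type*} [CommRing R] [AddCommGroup U] [Module R U]
    [Fintype I] (b : Module.Basis I R U) {n : ℕ} {x : ExteriorAlgebra R U}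
    (hx : x ∈ ⋀[R]^n U) :
    ∑ i, ι R (b i) * CliffordAlgebra.contractLeft (b.coord i) x = (n : R) • x := by
  induction n generalizing x with
  | zero => simp [contractLeft_exteriorPower_zero _ hx]
  | succ n ih =>
    refine exteriorPower_succ_induction (P := fun x =>
      ∑ i, ι R (b i) * CliffordAlgebra.contractLeft (b.coord i) x = ((n + 1 : ℕ) : R) • x)
      (fun u y hy => ?_) (fun y z hy hz => ?_) hx
    · have hanti (i : I) (z : ExteriorAlgebra R U) :
          ι R (b i) * (ι R u * z) = -(ι R u * (ι R (b i) * z)) := by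
        rw [← mul_assoc, ← mul_assoc, ← neg_mul]
        congr 1
        exact eq_neg_of_add_eq_zero_left (ι_add_mul_swap _ _)
      have hu : ∑ i, ι R (b i) * (b.coord i u • y) = ι R u * y := by
        simp_rw [mul_smul_comm, ← smul_mul_assoc, ← map_smul, ← Finset.sum_mul, ← map_sum,
          Module.Basis.coord_apply, b.sum_repr]
      simp_rw [contractLeft_ι_mul', mul_sub, Finset.sum_sub_distrib, hu, hanti,
        Finset.sum_neg_distrib, ← Finset.mul_sum, ih hy, mul_smul_comm]
      push_cast
      rw [add_smul, one_smul]
      abel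
    · simp_rw [map_add, mul_add, Finset.sum_add_distrib, hy, hz, smul_add]

lemma eq_zero_of_forall_ι_mul_eq_zero {R U I : Type*} [CommRing R] [AddCommGroup U] [Module R U]
    [Fintype I] (b : Module.Basis I R U) {n : ℕ} (hn : Fintype.card I = n + 1)
    {x : ExteriorAlgebra R U} (hx : x ∈ ⋀[R]^n U) (h : ∀ i, ι R (b i) * x = 0) : x = 0 := by
  have key : ∑ i, CliffordAlgebra.contractLeft (b.coord i) (ι R (b i) * x) = x := by
    simp_rw [contractLeft_ι_mul', Finset.sum_sub_distrib, sum_ι_mul_contractLeft b hx]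
    simp only [Module.Basis.coord_apply, Module.Basis.repr_self, Finsupp.single_eq_same, one_smul,
      Finset.sum_const, Finset.card_univ, hn, ← Nat.cast_smul_eq_nsmul R, ← sub_smul]
    simp
  rw [← key]
  simp [h]

lemma exists_dual_injOn_of_finrank_eq_one {F E : Type*} [Field F] [AddCommGroup E] [Module F E]
    (S : Submodule F E) (hS : Module.finrank F S = 1) :
    ∃ D : Module.Dual F E, ∀ y ∈ S, D y = 0 → y = 0 := by
  obtain ⟨e⟩ := Module.nonempty_linearEquiv_of_finrank_eq_one hS
  obtain ⟨D, hD⟩ := LinearMap.exists_extend (e.symm : S →ₗ[F] F)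
  refine ⟨D, fun y hy h => ?_⟩
  have := LinearMap.congr_fun hD ⟨y, hy⟩
  simpa [h] using this.symm

lemma exists_ι_mul_eq_zero {F U : Type*} [Field F] (h2 : (2 : F) ≠ 0) [AddCommGroup U]
    [Module F U] [FiniteDimensional F U] {n : ℕ} (hodd : Odd n)
    (hn : Module.finrank F U = n + 2) {x : ExteriorAlgebra F U} (hx : x ∈ ⋀[F]^n U) :
    ∃ v : U, v ≠ 0 ∧ ι F v * x = 0 := by
  let b := Module.finBasisOfFinrankEq F U hn
  obtain ⟨D, hD⟩ := exists_dual_injOn_of_finrank_eq_one (⋀[F]^(n + 2) U)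
    (by rw [exteriorPower.finrank_eq, hn, Nat.choose_self])
  obtain ⟨a, ha, hMa⟩ := exists_mulVec_eq_zero_of_transpose_eq_neg h2
    (by simpa using hodd.add_even even_two)
    (Matrix.of fun i j => D (ι F (b i) * (ι F (b j) * x))) (by
      ext i j
      simp only [Matrix.transpose_apply, Matrix.of_apply, Matrix.neg_apply, ← map_neg]
      congr 1
      rw [← mul_assoc, ← mul_assoc, ← neg_mul]
      congr 1
      exact eq_neg_of_add_eq_zero_left (ι_add_mul_swap _ _))
  refine ⟨∑ j, a j • b j, fun h => ha ?_, ?_⟩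
  · funext j
    exact Fintype.linearIndependent_iff.1 b.linearIndependent a h j
  · have hy := ι_mul_mem_exteriorPower_succ (∑ j, a j • b j) hx
    refine eq_zero_of_forall_ι_mul_eq_zero b (by simp) hy fun i => ?_
    refine hD _ (ι_mul_mem_exteriorPower_succ _ hy) ?_
    have := congrFun hMa i
    simp only [Matrix.mulVec, dotProduct, Matrix.of_apply, Pi.zero_apply] at this
    rw [← this]
    simp [Finset.sum_mul, Finset.mul_sum, mul_comm]

lemma exists_eq_ι_mul_of_ι_mul_eq_zero {F U : Type*} [Field F] [AddCommGroup U] [Module F U]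
    {n : ℕ} {x : ExteriorAlgebra F U} (hx : x ∈ ⋀[F]^(n + 1) U) {v : U} (hv : v ≠ 0)
    (h : ι F v * x = 0) : ∃ β ∈ ⋀[F]^n U, x = ι F v * β := by
  obtain ⟨f, hf⟩ := Module.Projective.exists_dual_eq_one F hv
  refine ⟨_, contractLeft_mem_exteriorPower f hx, ?_⟩
  have := contractLeft_ι_mul' f v x
  rwa [h, map_zero, hf, one_smul, eq_comm, sub_eq_zero] at this

lemma map_mem_exteriorPower {R U W : Type*} [CommRing R] [AddCommGroup U] [Module R U]
    [AddCommGroup W] [Module R W] (f : U →ₗ[R] W) {n : ℕ} {x : ExteriorAlgebra R U}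
    (hx : x ∈ ⋀[R]^n U) : ExteriorAlgebra.map f x ∈ ⋀[R]^n W := by
  induction n generalizing x with
  | zero =>
    rw [exteriorPower, pow_zero] at hx ⊢
    obtain ⟨r, rfl⟩ := Submodule.mem_one.1 hx
    exact Submodule.mem_one.2 ⟨r, by simp⟩
  | succ n ih =>
    refine exteriorPower_succ_induction (P := fun x => ExteriorAlgebra.map f x ∈ ⋀[R]^(n + 1) W)
      (fun u y hy => ?_) (fun y z hy hz => ?_) hx
    · rw [map_mul, map_apply_ι]
      exact ι_mul_mem_exteriorPower_succ _ (ih hy)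
    · rw [map_add]
      exact Submodule.add_mem _ hy hz

/-- Over a field of characteristic not two, every trivector on a space of dimension at most
five is divisible by a vector. -/
lemma exists_eq_ι_mul_of_finrank_le_five {F U : Type*} [Field F] (h2 : (2 : F) ≠ 0)
    [AddCommGroup U] [Module F U] [FiniteDimensional F U] (h5 : Module.finrank F U ≤ 5)
    {x : ExteriorAlgebra F U} (hx : x ∈ ⋀[F]^3 U) :
    ∃ (u : U) (β : ExteriorAlgebra F U), β ∈ ⋀[F]^2 U ∧ x = ι F u * β := by
  obtain ⟨s, hs⟩ := finrank_le_iff_exists_linearMap.1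
    (show Module.finrank F U ≤ Module.finrank F (Fin 5 → F) by simpa using h5)
  obtain ⟨π, hπ⟩ := s.exists_leftInverse_of_injective (LinearMap.ker_eq_bot.2 hs)
  have hsx := map_mem_exteriorPower s hx
  obtain ⟨v, hv, hvx⟩ := exists_ι_mul_eq_zero h2 (by decide) (by simp) hsx
  obtain ⟨β, hβ, h⟩ := exists_eq_ι_mul_of_ι_mul_eq_zero hsx hv hvx
  refine ⟨π v, ExteriorAlgebra.map π β, map_mem_exteriorPower π hβ, ?_⟩
  rw [← map_apply_ι, ← map_mul, ← h, ← AlgHom.comp_apply, map_comp_map, hπ, map_id,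
    AlgHom.id_apply]

lemma dualPiece_eq_liftAlternating_single {R U : Type*} [CommRing R] [AddCommGroup U]
    [Module R U] (k : ℕ) (A : U [⋀^Fin k]→ₗ[R] R) :
    dualPiece k A = liftAlternating (Pi.single k A) :=
  rfl

/-- `dualPiece` as a linear map in the alternating form. -/
noncomputable def dualPieceLinear (R U : Type*) [CommRing R] [AddCommGroup U] [Module R U]
    (k : ℕ) : (U [⋀^Fin k]→ₗ[R] R) →ₗ[R] Module.Dual R (ExteriorAlgebra R U) :=
  liftAlternating ∘ₗ LinearMap.single R (fun i => U [⋀^Fin i]→ₗ[R] R) k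

lemma dualPieceLinear_apply {R U : Type*} [CommRing R] [AddCommGroup U]
    [Module R U] (k : ℕ) (A : U [⋀^Fin k]→ₗ[R] R) :
    dualPieceLinear R U k A = dualPiece k A :=
  (dualPiece_eq_liftAlternating_single k A).symm

lemma span_dualPiece_eq_range {R U : Type*} [CommRing R] [AddCommGroup U] [Module R U] (k : ℕ) :
    Submodule.span R {φ | ∃ A : U [⋀^Fin k]→ₗ[R] R, φ = dualPiece k A} =
      LinearMap.range (dualPieceLinear R U k) := by
  have : {φ | ∃ A : U [⋀^Fin k]→ₗ[R] R, φ = dualPiece k A} =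
      (LinearMap.range (dualPieceLinear R U k) : Set _) := by
    ext φ
    simp [dualPieceLinear_apply, eq_comm]
  rw [this, Submodule.span_eq]

lemma disjoint_range_dualPieceLinear {R U : Type*} [CommRing R] [AddCommGroup U] [Module R U]
    (k : ℕ) :
    Disjoint (LinearMap.range (dualPieceLinear R U k)) (⋀[R]^k U).dualAnnihilator := by
  rw [Submodule.disjoint_def]
  rintro _ ⟨A, rfl⟩ hA
  have : A = 0 := by
    ext v
    have h := (Submodule.mem_dualAnnihilator _).1 hA (ιMulti R k v)
      (ιMulti_range R k (Set.mem_range_self v))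
    rw [dualPieceLinear_apply, dualPiece_eq_liftAlternating_single,
      liftAlternating_apply_ιMulti, Pi.single_eq_same] at h
    exact h
  rw [this, map_zero]

lemma finite_range_dualPieceLinear (F U : Type*) [Field F] [AddCommGroup U] [Module F U]
    [FiniteDimensional F U] (k : ℕ) :
    FiniteDimensional F (LinearMap.range (dualPieceLinear F U k)) := by
  have : FiniteDimensional F (U [⋀^Fin k]→ₗ[F] F) :=
    Module.Finite.equiv (exteriorPower.alternatingMapLinearEquiv (R := F) (n := k)).symm
  infer_instance

/-- Double annihilators inside a fixed degree of the exterior algebra. -/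
lemma range_inf_dualAnnihilator_exteriorPower_inf {F U : Type*} [Field F] [AddCommGroup U]
    [Module F U] [FiniteDimensional F U] (k : ℕ)
    (K : Submodule F (Module.Dual F (ExteriorAlgebra F U)))
    (hK : K ≤ LinearMap.range (dualPieceLinear F U k)) :
    LinearMap.range (dualPieceLinear F U k) ⊓
      (⋀[F]^k U ⊓ K.dualCoannihilator).dualAnnihilator = K := by
  have := finite_range_dualPieceLinear F U k
  have : FiniteDimensional F K := Submodule.finiteDimensional_of_le hK
  rw [Subspace.dualAnnihilator_inf_eq, Subspace.dualCoannihilator_dualAnnihilator_eq,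
    inf_sup_assoc_of_le _ hK |>.symm, (disjoint_range_dualPieceLinear k).eq_bot, bot_sup_eq]

/-- Let `p` be an odd prime and `0 → V → G → U → 0` a central extension of `𝔽_p`-vector
spaces with `exp(G) = p`, surjective commutator map `γ : Λ²U → V` (here the alternating
bilinear map `γb`), and `dim U ≤ 5`.  Then every element of `Λ³U` can be written as `u ∧ β`
with `u ∈ U`, `β ∈ Λ²U`; consequently the subgroup `S³_dec` of
`S³ = (K³)^⊥ = (V^∨ ∧ U^∨)^⊥ ⊆ Λ³U` generated by the elements of the form `u ∧ β` equals
`S³` itself, and hence `K³_max = (S³_dec)^⊥ = K³`.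

Here `K³ = V^∨ ∧ U^∨` is realized as the space of linear functionals on `Λ³U` spanned by
the 3-forms `γ^∨(ρ) ∧ w` (`ρ ∈ V^∨`, `w ∈ U^∨`); `B ρ` is the 2-form `γ^∨(ρ) = ρ ∘ γ` and
`W3 A w` is the wedge `A ∧ w` of a `2`-form with a `1`-form, both characterized by their
values. -/
theorem stmt11 (p : ℕ) [Fact p.Prime] (hodd : Odd p)
    (U V : Type) [AddCommGroup U] [Module (ZMod p) U] [FiniteDimensional (ZMod p) U]
    [AddCommGroup V] [Module (ZMod p) V] [FiniteDimensional (ZMod p) V]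
    (h5 : Module.finrank (ZMod p) U ≤ 5)
    (γb : U →ₗ[ZMod p] U →ₗ[ZMod p] V) (hγalt : ∀ u : U, γb u u = 0)
    (hγsurj : ∀ v : V, v ∈ Submodule.span (ZMod p) {w : V | ∃ a b : U, w = γb a b})
    (B : Module.Dual (ZMod p) V → (U [⋀^Fin 2]→ₗ[ZMod p] ZMod p))
    (hB : ∀ ρ v₁ v₂, B ρ ![v₁, v₂] = ρ (γb v₁ v₂))
    (W3 : (U [⋀^Fin 2]→ₗ[ZMod p] ZMod p) → Module.Dual (ZMod p) U →
      (U [⋀^Fin 3]→ₗ[ZMod p] ZMod p))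
    (hW3 : ∀ A w v₁ v₂ v₃, W3 A w ![v₁, v₂, v₃]
      = A ![v₁, v₂] * w v₃ - A ![v₁, v₃] * w v₂ + A ![v₂, v₃] * w v₁) :
    ∀ (K3 : Submodule (ZMod p) (Module.Dual (ZMod p) (ExteriorAlgebra (ZMod p) U))),
      K3 = Submodule.span (ZMod p)
        {φ | ∃ (ρ : Module.Dual (ZMod p) V) (w : Module.Dual (ZMod p) U),
          φ = dualPiece 3 (W3 (B ρ) w)} →
    ∀ (S3 : Submodule (ZMod p) (ExteriorAlgebra (ZMod p) U)),
      S3 = ⋀[ZMod p]^3 U ⊓ K3.dualCoannihilator →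
    ∀ (S3dec : Submodule (ZMod p) (ExteriorAlgebra (ZMod p) U)),
      S3dec = Submodule.span (ZMod p)
        {x | x ∈ S3 ∧ ∃ (u : U) (β : ExteriorAlgebra (ZMod p) U),
          β ∈ ⋀[ZMod p]^2 U ∧ x = ι (ZMod p) u * β} →
    -- every trivector is partially decomposable:
    (∀ x ∈ ⋀[ZMod p]^3 U, ∃ (u : U) (β : ExteriorAlgebra (ZMod p) U),
        β ∈ ⋀[ZMod p]^2 U ∧ x = ι (ZMod p) u * β) ∧
    -- hence `S³_dec = S³`:
    S3dec = S3 ∧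
    -- and `K³_max = K³`:
    (Submodule.span (ZMod p) {φ | ∃ A : U [⋀^Fin 3]→ₗ[ZMod p] ZMod p, φ = dualPiece 3 A}
        ⊓ S3dec.dualAnnihilator) = K3 := by
  intro K3 hK3 S3 hS3 S3dec hS3dec
  have h2 : (2 : ZMod p) ≠ 0 := by
    have : NeZero (2 : ZMod p) := ⟨Ring.two_ne_zero (by
      rw [ZMod.ringChar_zmod_n]
      rintro rfl
      exact absurd hodd (by decide))⟩
    exact two_ne_zero
  have hdec : ∀ x ∈ ⋀[ZMod p]^3 U, ∃ (u : U) (β : ExteriorAlgebra (ZMod p) U),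
      β ∈ ⋀[ZMod p]^2 U ∧ x = ι (ZMod p) u * β :=
    fun x hx => exists_eq_ι_mul_of_finrank_le_five h2 h5 hx
  have hS : S3dec = S3 := by
    rw [hS3dec]
    refine le_antisymm (Submodule.span_le.2 fun x hx => hx.1) fun x hx => ?_
    exact Submodule.subset_span ⟨hx, hdec x (hS3 ▸ hx).1⟩
  refine ⟨hdec, hS, ?_⟩
  rw [hS, hS3, span_dualPiece_eq_range]
  refine range_inf_dualAnnihilator_exteriorPower_inf 3 K3 ?_
  rw [hK3, Submodule.span_le]
  rintro _ ⟨ρ, w, rfl⟩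
  exact ⟨_, dualPieceLinear_apply 3 _⟩
end
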